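/- arXiv:math/9811035 — 2 statements merged into one kernel-verified Lean document; each statement's English description precedes it below -/
import Mathlib

section
/- Let J be a reduced Albert algebra over a field F of characteristic not 2 or 3 and let V ⊆ J be a totally singular subspace. Then I := {(α, 0; v, 0) : α ∈ F, v ∈ V} is an inner ideal of B(J,F×F), and every nonzero element of I is singular (so I is a singular ideal). -/
set_option synthInstance.maxHeartbeats 1000000
set_option maxHeartbeats 1000000

noncomputable section

open scoped TensorProduct

universe u v

structure OctonionAlgebra (F : Type u) [Field F] : Type (max u (v + 1)) where
  C : Type v
  [ringC : NonAssocRing C]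
  [modC : Module F C]
  [sccC : SMulCommClass F C C]
  [istC : IsScalarTower F C C]
  n : QuadraticForm F C
  finrank_eq : Module.finrank F C = 8
  nondeg : ∀ x : C, (∀ y : C, QuadraticMap.polar (⇑n) x y = 0) → x = 0
  n_one : n 1 = 1
  n_mul : ∀ x y : C, n (x * y) = n x * n y

attribute [instance] OctonionAlgebra.ringC OctonionAlgebra.modC OctonionAlgebra.sccC
  OctonionAlgebra.istC

namespace OctonionAlgebra

variable {F : Type u} [Field F] (O : OctonionAlgebra.{u, v} F)

/-- Conjugation `x̄ := n(x,1)•1 - x` (bundled as a linear map; `polarBilin n x 1 = n(x,1)`). -/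
def conj : O.C →ₗ[F] O.C :=
  (LinearMap.toSpanSingleton F O.C (1 : O.C)).comp ((QuadraticMap.polarBilin O.n).flip 1)
    - LinearMap.id

lemma conj_apply (x : O.C) :
    O.conj x = QuadraticMap.polar (⇑O.n) x 1 • (1 : O.C) - x := rfl

/-- A split octonion algebra: the norm form is isotropic. -/
def IsSplit : Prop := ∃ x : O.C, x ≠ 0 ∧ O.n x = 0

end OctonionAlgebra

/-- A reduced Albert algebra `H₃(C,γ)`. -/
structure ReducedAlbert (F : Type u) [Field F] : Type (max u (v + 1)) where
  O : OctonionAlgebra.{u, v} F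
  γ : Fin 3 → Fˣ

namespace ReducedAlbert

variable {F : Type u} [Field F] (A : ReducedAlbert.{u, v} F)

/-- The ambient space of 3×3 matrices over the octonion algebra. -/
abbrev M : Type v := Matrix (Fin 3) (Fin 3) A.O.C

/-- The 27-dimensional space `H₃(C,γ)` of `γ`-hermitian matrices:
`x = γ⁻¹ ⬝ (x̄)ᵀ ⬝ γ`, i.e. entrywise `x i j = γᵢ⁻¹ γⱼ • conj (x j i)`. -/
def J : Submodule F A.M where
  carrier := {x | ∀ i j, x i j = ((A.γ i : F)⁻¹ * (A.γ j : F)) • A.O.conj (x j i)}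
  add_mem' := by
    intro a b ha hb i j
    show a i j + b i j = ((A.γ i : F)⁻¹ * (A.γ j : F)) • A.O.conj (a j i + b j i)
    rw [map_add, smul_add, ← ha i j, ← hb i j]
  zero_mem' := by
    intro i j
    show (0 : A.O.C) = ((A.γ i : F)⁻¹ * (A.γ j : F)) • A.O.conj (0 : A.O.C)
    rw [map_zero, smul_zero]
  smul_mem' := by
    intro c a ha i j
    show c • a i j = ((A.γ i : F)⁻¹ * (A.γ j : F)) • A.O.conj (c • a j i)
    rw [map_smul, smul_comm, ← ha i j]

/-- The Jordan product `x·y := (xy + yx)/2`. -/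
def jmul (x y : A.M) : A.M := (2 : F)⁻¹ • (x * y + y * x)

/-- The trace `T(x)`: the sum of the diagonal entries, which for hermitian matrices are
scalars `ε•1`; the scalar `ε` is recovered as `n(ε•1, 1)/2`. -/
def trace (x : A.M) : F := (2 : F)⁻¹ * ∑ i, QuadraticMap.polar (⇑A.O.n) (x i i) 1

/-- The trace bilinear form `T(x,y) := T(x·y)`. -/
def tb (x y : A.M) : F := A.trace (A.jmul x y)

/-- The adjoint `x ^ # = x·x − T(x)·x + ½(T(x)² − T(x,x))·1`, the unique quadratic map such
that `T(x^#, y)` is the coefficient of `s` in `N(x + s y)`. -/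
def sharp (x : A.M) : A.M :=
  A.jmul x x - A.trace x • x + ((2 : F)⁻¹ * (A.trace x ^ 2 - A.tb x x)) • (1 : A.M)

/-- The Freudenthal cross product `x × y := (x+y)^# − x^# − y^#`. -/
def cross (x y : A.M) : A.M := A.sharp (x + y) - A.sharp x - A.sharp y

/-- The cubic norm `N`, defined pointwise on `J` by
`N(x)·1 = x·(x·x) − T(x)·(x·x) + ½(T(x)² − T(x,x))·x`; the scalar is recovered by
applying the trace (which takes value `3` on `1`). -/
def norm (x : A.M) : F :=
  (3 : F)⁻¹ * A.trace (A.jmul x (A.jmul x x) - A.trace x • A.jmul x x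
    + ((2 : F)⁻¹ * (A.trace x ^ 2 - A.tb x x)) • x)

/-- The operator `⟨x,y⟩(j) := ½ (y × (x × j) − T(j,y)·x − ⅓·T(x,y)·j)`. -/
def brok (x y j : A.M) : A.M :=
  (2 : F)⁻¹ • (A.cross y (A.cross x j) - A.tb j y • x - ((3 : F)⁻¹ * A.tb x y) • j)

/-- `A` is the split Albert algebra `H₃(Cᵈ, 1)`. -/
def IsSplitAlbert : Prop := A.O.IsSplit ∧ ∀ i, A.γ i = 1

/-- A point of `H₃(C,γ)` with coordinates `(ε₀,ε₁,ε₂; a,b,c)`. -/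
def elt (ε : Fin 3 → F) (a b c : A.O.C) : A.M :=
  Matrix.of
    ![![ε 0 • (1 : A.O.C), c, ((A.γ 0 : F)⁻¹ * (A.γ 2 : F)) • A.O.conj b],
      ![((A.γ 1 : F)⁻¹ * (A.γ 0 : F)) • A.O.conj c, ε 1 • (1 : A.O.C), a],
      ![b, ((A.γ 2 : F)⁻¹ * (A.γ 1 : F)) • A.O.conj a, ε 2 • (1 : A.O.C)]]

/-! ### The Brown algebra `B(J, F×F, ζ)` -/

/-- Ambient space of the Brown algebra `B(J, F×F, ζ)`: elements `(α, j; j', β)`. -/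
abbrev Bam : Type (max u v) := F × A.M × A.M × F

/-- The underlying 56-dimensional space of `B(J, F×F, ζ)`: both middle components lie in `J`. -/
def Bsub : Submodule F A.Bam where
  carrier := {p | p.2.1 ∈ A.J ∧ p.2.2.1 ∈ A.J}
  add_mem' := fun ha hb => ⟨A.J.add_mem ha.1 hb.1, A.J.add_mem ha.2 hb.2⟩
  zero_mem' := ⟨A.J.zero_mem, A.J.zero_mem⟩
  smul_mem' := fun c _ h => ⟨A.J.smul_mem c h.1, A.J.smul_mem c h.2⟩

/-- The product of `B(J, F×F, ζ)`. -/
def bmul (ζ : F) (x y : A.Bam) : A.Bam :=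
  (x.1 * y.1 + ζ * A.tb x.2.1 y.2.2.1,
   x.1 • y.2.1 + y.2.2.2 • x.2.1 + ζ • A.cross x.2.2.1 y.2.2.1,
   y.1 • x.2.2.1 + x.2.2.2 • y.2.2.1 + A.cross x.2.1 y.2.1,
   x.2.2.2 * y.2.2.2 + ζ * A.tb y.2.1 x.2.2.1)

/-- The involution `(α,j;j',β)‾ = (β,j;j',α)` of `B(J, F×F, ζ)`. -/
def binv (x : A.Bam) : A.Bam := (x.2.2.2, x.2.1, x.2.2.1, x.1)

/-- The skew-symmetric element `s₀ = (1,0;0,−1)`. -/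
def s0 : A.Bam := (1, 0, 0, -1)

/-- The triple product `{x,y,z} := (x·ȳ)·z + (z·ȳ)·x − (z·x̄)·y` in `B(J, F×F, ζ)`. -/
def brace (ζ : F) (x y z : A.Bam) : A.Bam :=
  A.bmul ζ (A.bmul ζ x (A.binv y)) z + A.bmul ζ (A.bmul ζ z (A.binv y)) x
    - A.bmul ζ (A.bmul ζ z (A.binv x)) y

/-- The bilinear form of the triple system associated to `B(J, F×F, ζ)` and a skew element
`s`: `b(x,y)` is the unique scalar with `b(x,y)•1 = (x·ȳ − y·x̄)·s`; since the unit of the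
algebra is `(1,0;0,1)`, it is the first component of the right-hand side. -/
def bformS (ζ : F) (s x y : A.Bam) : F :=
  (A.bmul ζ (A.bmul ζ x (A.binv y) - A.bmul ζ y (A.binv x)) s).1

/-- The trilinear product of the triple system associated to `B(J, F×F, ζ)` and `s`:
`t(y,z,w) := 2{y, s·z, w} − b(z,w)·y − b(z,y)·w − b(y,w)·z`. -/
def tformS (ζ : F) (s y z w : A.Bam) : A.Bam :=
  (2 : F) • A.brace ζ y (A.bmul ζ s z) w - A.bformS ζ s z w • y - A.bformS ζ s z y • w
    - A.bformS ζ s y w • z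

/-- The bilinear form of the triple system associated to `B(J, F×F, ζ)` and `s₀`. -/
def bform (ζ : F) (x y : A.Bam) : F := A.bformS ζ A.s0 x y

/-- The trilinear product of the triple system associated to `B(J, F×F, ζ)` and `s₀`. -/
def tform (ζ : F) (y z w : A.Bam) : A.Bam := A.tformS ζ A.s0 y z w

/-- `e` is a singular element of `B(J, F×F, ζ)`: `e ≠ 0` and `U_e(B) ⊆ F·e`
where `U_e(x) := {e,x,e}`. -/
def IsSingular (ζ : F) (e : A.Bam) : Prop :=
  e ≠ 0 ∧ ∀ x ∈ A.Bsub, ∃ c : F, A.brace ζ e x e = c • e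

/-- `I` is an inner ideal of `B(J, F×F, ζ)`: a subspace of `B` with `U_e(B) ⊆ I`
for all `e ∈ I`. -/
def IsInnerIdeal (ζ : F) (I : Submodule F A.Bam) : Prop :=
  I ≤ A.Bsub ∧ ∀ e ∈ I, ∀ x ∈ A.Bsub, A.brace ζ e x e ∈ I

end ReducedAlbert


namespace OctonionAlgebra

variable {F : Type u} [Field F] (O : OctonionAlgebra.{u, v} F)

lemma polar_mul_left (x y z : O.C) :
    QuadraticMap.polar (⇑O.n) (x * y) (x * z) = O.n x * QuadraticMap.polar (⇑O.n) y z := by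
  simp only [QuadraticMap.polar, ← mul_add, O.n_mul]
  ring

lemma polar_mul_right (x y z : O.C) :
    QuadraticMap.polar (⇑O.n) (x * z) (y * z) = QuadraticMap.polar (⇑O.n) x y * O.n z := by
  simp only [QuadraticMap.polar, ← add_mul, O.n_mul]
  ring

lemma polar_mul_add_polar_mul_left (x y z : O.C) :
    QuadraticMap.polar (⇑O.n) (x * y) z + QuadraticMap.polar (⇑O.n) y (x * z)
      = QuadraticMap.polar (⇑O.n) x 1 * QuadraticMap.polar (⇑O.n) y z := by
  have h := O.polar_mul_left (x + 1) y z
  simp only [add_mul, one_mul, QuadraticMap.polar_add_left, QuadraticMap.polar_add_right,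
    O.polar_mul_left] at h
  have hx : QuadraticMap.polar (⇑O.n) x 1 = O.n (x + 1) - O.n x - 1 := by
    rw [QuadraticMap.polar, O.n_one]
  rw [hx]
  linear_combination h

lemma polar_mul_add_polar_mul_right (x y z : O.C) :
    QuadraticMap.polar (⇑O.n) (x * y) z + QuadraticMap.polar (⇑O.n) x (z * y)
      = QuadraticMap.polar (⇑O.n) x z * QuadraticMap.polar (⇑O.n) y 1 := by
  have h := O.polar_mul_right x z (y + 1)
  simp only [mul_add, mul_one, QuadraticMap.polar_add_left, QuadraticMap.polar_add_right,
    O.polar_mul_right] at h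
  have hy : QuadraticMap.polar (⇑O.n) y 1 = O.n (y + 1) - O.n y - 1 := by
    rw [QuadraticMap.polar, O.n_one]
  rw [hy]
  linear_combination h

lemma polar_mul_one (x y : O.C) :
    QuadraticMap.polar (⇑O.n) (x * y) 1
      = QuadraticMap.polar (⇑O.n) x 1 * QuadraticMap.polar (⇑O.n) y 1
        - QuadraticMap.polar (⇑O.n) y x := by
  have h := O.polar_mul_add_polar_mul_left x y 1
  rw [mul_one] at h
  linear_combination h

lemma polar_mul_comm (x y : O.C) :
    QuadraticMap.polar (⇑O.n) (x * y) 1 = QuadraticMap.polar (⇑O.n) (y * x) 1 := by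
  rw [polar_mul_one, polar_mul_one, QuadraticMap.polar_comm (⇑O.n) x y]
  ring

lemma polar_mul_assoc (x y z : O.C) :
    QuadraticMap.polar (⇑O.n) (x * y * z) 1 = QuadraticMap.polar (⇑O.n) (x * (y * z)) 1 := by
  have h1 := O.polar_mul_add_polar_mul_left x y z
  have h2 := O.polar_mul_add_polar_mul_right y z x
  rw [polar_mul_one, polar_mul_one O x (y * z), polar_mul_one, polar_mul_one,
    QuadraticMap.polar_comm (⇑O.n) z (x * y), QuadraticMap.polar_comm (⇑O.n) z y]
  linear_combination h2 - h1

end OctonionAlgebra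

namespace ReducedAlbert

variable {F : Type u} [Field F] (A : ReducedAlbert.{u, v} F)

lemma trace_add (x y : A.M) : A.trace (x + y) = A.trace x + A.trace y := by
  simp only [trace, Matrix.add_apply, QuadraticMap.polar_add_left, Finset.sum_add_distrib, mul_add]

lemma trace_smul (c : F) (x : A.M) : A.trace (c • x) = c * A.trace x := by
  simp only [trace, Matrix.smul_apply, QuadraticMap.polar_smul_left, smul_eq_mul,
    ← Finset.mul_sum]
  ring

lemma trace_sub (x y : A.M) : A.trace (x - y) = A.trace x - A.trace y := by
  simp only [trace, Matrix.sub_apply, QuadraticMap.polar_sub_left, Finset.sum_sub_distrib, mul_sub]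

lemma polar_sum_left {ι : Type*} (s : Finset ι) (f : ι → A.O.C) (y : A.O.C) :
    QuadraticMap.polar (⇑A.O.n) (∑ i ∈ s, f i) y
      = ∑ i ∈ s, QuadraticMap.polar (⇑A.O.n) (f i) y :=
  map_sum ((QuadraticMap.polarBilin A.O.n).flip y) f s

lemma trace_mul_comm (x y : A.M) : A.trace (x * y) = A.trace (y * x) := by
  simp only [trace, Matrix.mul_apply, polar_sum_left]
  rw [Finset.sum_comm]
  simp only [A.O.polar_mul_comm]

lemma trace_mul_assoc (x y z : A.M) : A.trace (x * y * z) = A.trace (x * (y * z)) := by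
  simp only [trace, Matrix.mul_apply, polar_sum_left, Finset.sum_mul, Finset.mul_sum,
    A.O.polar_mul_assoc]
  exact Finset.sum_congr rfl fun i _ => Finset.sum_comm

lemma tb_eq (h2 : (2 : F) ≠ 0) (x y : A.M) : A.tb x y = A.trace (x * y) := by
  rw [tb, jmul, trace_smul, trace_add, A.trace_mul_comm y x]
  field_simp
  ring

lemma sharp_eq (h2 : (2 : F) ≠ 0) (x : A.M) :
    A.sharp x = x * x - A.trace x • x
      + ((2 : F)⁻¹ * (A.trace x ^ 2 - A.trace (x * x))) • (1 : A.M) := by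
  rw [sharp, tb_eq A h2, jmul, ← two_smul F (x * x), inv_smul_smul₀ h2]

lemma trace_sharp_mul (h2 : (2 : F) ≠ 0) (x y : A.M) :
    A.trace (A.sharp x * y) = A.trace (x * x * y) - A.trace x * A.trace (x * y)
      + (2 : F)⁻¹ * (A.trace x ^ 2 - A.trace (x * x)) * A.trace y := by
  simp only [sharp_eq A h2, sub_mul, add_mul, smul_mul_assoc, one_mul, trace_add, trace_sub,
    trace_smul]

/-- The trilinear form `T(x × y, z)` is symmetric, in the special case `z = x`. -/
lemma tb_cross_self (h2 : (2 : F) ≠ 0) (x y : A.M) :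
    A.tb (A.cross x y) x = 2 * A.tb (A.sharp x) y := by
  have hc : A.trace (y * x * x) = A.trace (x * x * y) := by
    rw [trace_mul_assoc, trace_mul_comm]
  have hd : A.trace (x * y * x) = A.trace (x * x * y) := by
    rw [trace_mul_comm, trace_mul_assoc]
  simp only [tb_eq A h2, cross, sub_mul, trace_sub, trace_sharp_mul A h2, mul_add, add_mul,
    trace_add, hc, hd, A.trace_mul_comm y x]
  field_simp
  ring

lemma sharp_smul (h2 : (2 : F) ≠ 0) (c : F) (x : A.M) :
    A.sharp (c • x) = (c ^ 2) • A.sharp x := by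
  simp only [sharp_eq A h2, smul_mul_assoc, mul_smul_comm, trace_smul, smul_sub, smul_add,
    smul_smul]
  congr 2 <;> ring_nf

lemma sharp_zero : A.sharp 0 = 0 := by
  simp [sharp, jmul, tb, trace]

lemma cross_zero_left (x : A.M) : A.cross 0 x = 0 := by
  simp [cross, sharp_zero]

lemma cross_zero_right (x : A.M) : A.cross x 0 = 0 := by
  simp [cross, sharp_zero]

lemma cross_smul_self_of_sharp_eq_zero (h2 : (2 : F) ≠ 0) {x : A.M} (hx : A.sharp x = 0) (c : F) :
    A.cross (c • x) x = 0 := by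
  have h : c • x + x = (c + 1) • x := by rw [add_smul, one_smul]
  rw [cross, h, sharp_smul A h2, sharp_smul A h2, hx]
  simp

lemma tb_zero_left (x : A.M) : A.tb 0 x = 0 := by
  simp [tb, jmul, trace]

lemma tb_zero_right (x : A.M) : A.tb x 0 = 0 := by
  simp [tb, jmul, trace]

lemma tb_add_left (h2 : (2 : F) ≠ 0) (x y z : A.M) : A.tb (x + y) z = A.tb x z + A.tb y z := by
  simp only [tb_eq A h2, add_mul, trace_add]

lemma tb_smul_left (h2 : (2 : F) ≠ 0) (c : F) (x y : A.M) : A.tb (c • x) y = c * A.tb x y := by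
  simp only [tb_eq A h2, smul_mul_assoc, trace_smul]

lemma tb_cross_self_of_sharp_eq_zero (h2 : (2 : F) ≠ 0) {x : A.M} (hx : A.sharp x = 0) (y : A.M) :
    A.tb (A.cross x y) x = 0 := by
  rw [tb_cross_self A h2, hx, tb_zero_left, mul_zero]

/-- For `v^# = 0`, the operator `U_e` of `e = (α, 0; v, 0)` takes values in `F e`. -/
lemma brace_self_of_sharp_eq_zero (h2 : (2 : F) ≠ 0) {v : A.M} (hv : A.sharp v = 0) (α : F)
    (x : A.Bam) :
    A.brace 1 (α, 0, v, 0) x (α, 0, v, 0)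
      = (2 * (α * x.2.2.2 + A.tb x.2.1 v)) • ((α, 0, v, 0) : A.Bam) := by
  obtain ⟨b, j, j', c⟩ := x
  have hvv : A.cross v v = 0 := by
    simpa using A.cross_smul_self_of_sharp_eq_zero h2 hv 1
  simp only [brace, bmul, binv, cross_zero_left, cross_zero_right, tb_zero_left, tb_zero_right, hvv,
    A.cross_smul_self_of_sharp_eq_zero h2 hv, tb_add_left A h2, tb_smul_left A h2,
    A.tb_cross_self_of_sharp_eq_zero h2 hv, smul_zero, zero_smul, one_smul, mul_zero, zero_mul,
    add_zero, zero_add, one_mul]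
  ext1
  · simp
    ring
  ext1
  · simp
  ext1
  · simp
    module
  · simp

end ReducedAlbert

/-- For a totally singular subspace `V ⊆ J`, the subspace
`I = {(α, 0; v, 0) : α ∈ F, v ∈ V}` is an inner ideal of `B(J,F×F)` all of whose nonzero
elements are singular (a singular ideal). -/
theorem stmt10 {F : Type u} [Field F] (h2 : (2 : F) ≠ 0) (h3 : (3 : F) ≠ 0)
    (A : ReducedAlbert.{u, v} F) (V : Submodule F A.M) (hVJ : V ≤ A.J)
    (hV : ∀ v ∈ V, A.sharp v = 0) :
    ∃ I : Submodule F A.Bam,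
      (I : Set A.Bam) = {p : A.Bam | ∃ α : F, ∃ v ∈ V, p = (α, 0, v, 0)} ∧
      A.IsInnerIdeal 1 I ∧
      ∀ e ∈ I, e ≠ 0 → A.IsSingular 1 e := by
  refine ⟨(⊤ : Submodule F F).prod ((⊥ : Submodule F A.M).prod (V.prod (⊥ : Submodule F F))),
    ?_, ⟨?_, ?_⟩, ?_⟩
  · ext ⟨a, j, v, b⟩
    simp only [SetLike.mem_coe, Submodule.mem_prod, Submodule.mem_top, Submodule.mem_bot,
      Set.mem_ofPred_eq, Prod.mk.injEq]
    aesop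
  · rintro ⟨a, j, v, b⟩ ⟨-, hj, hv, -⟩
    obtain rfl : j = 0 := hj
    exact ⟨A.J.zero_mem, hVJ hv⟩
  · rintro ⟨a, j, v, b⟩ he x -
    obtain rfl : j = 0 := he.2.1
    obtain rfl : b = 0 := he.2.2.2
    rw [A.brace_self_of_sharp_eq_zero h2 (hV v he.2.2.1)]
    exact Submodule.smul_mem _ _ he
  · rintro ⟨a, j, v, b⟩ he hne
    obtain rfl : j = 0 := he.2.1
    obtain rfl : b = 0 := he.2.2.2
    exact ⟨hne, fun x _ => ⟨_, A.brace_self_of_sharp_eq_zero h2 (hV v he.2.2.1) a x⟩⟩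
end
end

section
/- Let J be a reduced Albert algebra over a field F of characteristic not 2 or 3 and let d ∈ J be rank one (d ≠ 0, d^# = 0). Then I := {(α, ξ·d; d×k, 0) : α, ξ ∈ F, k ∈ J} is a 12-dimensional inner ideal of B(J,F×F) which is not singular: its element (1, d; 0, 0) is nonzero and not singular. -/
set_option synthInstance.maxHeartbeats 1000000
set_option maxHeartbeats 1000000

noncomputable section

open scoped TensorProduct

universe u v

/-- Three nondegenerate quadratic forms on `V` with bilinear products
`m i : V (i+1) × V (i+2) → V i` that permit composition and whose trilinear form is cyclic. -/
structure CompositionTriple (F : Type u) (V : Type v) [Field F] [AddCommGroup V]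
    [Module F V] where
  Q : Fin 3 → QuadraticForm F V
  m : Fin 3 → V →ₗ[F] V →ₗ[F] V
  comp : ∀ i a b, Q i (m i a b) = Q (i + 1) a * Q (i + 2) b
  cyclic : ∀ i a b c, (Q i).polarBilin (m i a b) c = (Q (i + 1)).polarBilin (m (i + 1) b c) a
  nondeg : ∀ i a, (∀ b, (Q i).polarBilin a b = 0) → a = 0

namespace CompositionTriple

@[simp] lemma one_add_one (i : Fin 3) : i + 1 + 1 = i + 2 := by decide +revert
@[simp] lemma one_add_two (i : Fin 3) : i + 1 + 2 = i := by decide +revert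
@[simp] lemma two_add_one (i : Fin 3) : i + 2 + 1 = i := by decide +revert
@[simp] lemma two_add_two (i : Fin 3) : i + 2 + 2 = i + 1 := by decide +revert

lemma sum_cyclic {R : Type*} [AddCommMonoid R] (f : Fin 3 → R) (i : Fin 3) :
    ∑ j, f j = f i + f (i + 1) + f (i + 2) := by
  rw [Fin.sum_univ_three]
  fin_cases i
  · rfl
  · change _ = f 1 + f 2 + f 0
    abel
  · change _ = f 2 + f 0 + f 1
    abel

lemma funext_cyclic {R : Type*} {x y : Fin 3 → R} (i : Fin 3) (h0 : x i = y i)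
    (h1 : x (i + 1) = y (i + 1)) (h2 : x (i + 2) = y (i + 2)) : x = y := by
  funext j
  have : j = i ∨ j = i + 1 ∨ j = i + 2 := by clear h0 h1 h2; decide +revert
  rcases this with rfl | rfl | rfl <;> assumption

variable {F : Type u} {V : Type v} [Field F] [AddCommGroup V] [Module F V]
  (S : CompositionTriple F V)

/-- The polar form of the `i`-th quadratic form. -/
def B (i : Fin 3) : V →ₗ[F] V →ₗ[F] F := (S.Q i).polarBilin

lemma B_apply (i : Fin 3) (a b : V) : S.B i a b = S.Q i (a + b) - S.Q i a - S.Q i b := rfl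

lemma Q_add (i : Fin 3) (a b : V) : S.Q i (a + b) = S.Q i a + S.Q i b + S.B i a b := by
  rw [B_apply]; ring

lemma Q_neg (i : Fin 3) (a : V) : S.Q i (-a) = S.Q i a := QuadraticMap.map_neg _ _

lemma Q_smul (i : Fin 3) (t : F) (a : V) : S.Q i (t • a) = t * t * S.Q i a :=
  QuadraticMap.map_smul _ _ _

lemma B_comm (i : Fin 3) (a b : V) : S.B i a b = S.B i b a := by
  rw [B_apply, B_apply, add_comm a b]; ring

lemma B_self (i : Fin 3) (a : V) : S.B i a a = 2 * S.Q i a := by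
  have := S.Q_smul i 2 a
  rw [two_smul] at this
  rw [B_apply, this]; ring

lemma B_cyclic (i : Fin 3) (a b c : V) : S.B i (S.m i a b) c = S.B (i + 1) (S.m (i + 1) b c) a :=
  S.cyclic i a b c

lemma B_cyclic' (i : Fin 3) (a b c : V) :
    S.B i (S.m i a b) c = S.B (i + 2) (S.m (i + 2) c a) b := by
  rw [B_cyclic, B_cyclic, one_add_one]

lemma ext_B (i : Fin 3) {a b : V} (h : ∀ c, S.B i a c = S.B i b c) : a = b := by
  refine sub_eq_zero.1 (S.nondeg i _ fun c => ?_)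
  have := h c
  rw [← sub_eq_zero, ← LinearMap.sub_apply, ← map_sub] at this
  exact this

lemma B_mul_left (i : Fin 3) (a b c : V) :
    S.B i (S.m i a b) (S.m i a c) = S.Q (i + 1) a * S.B (i + 2) b c := by
  rw [B_apply, B_apply, ← map_add, comp, comp, comp]; ring

lemma B_mul_right (i : Fin 3) (a b c : V) :
    S.B i (S.m i a c) (S.m i b c) = S.B (i + 1) a b * S.Q (i + 2) c := by
  rw [B_apply, B_apply, ← LinearMap.add_apply, ← map_add, comp, comp, comp]; ring

lemma B_mul_mul (i : Fin 3) (a b c d : V) :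
    S.B i (S.m i a b) (S.m i c d) + S.B i (S.m i a d) (S.m i c b)
      = S.B (i + 1) a c * S.B (i + 2) b d := by
  have h := S.B_mul_right i a c (b + d)
  simp only [map_add, LinearMap.add_apply, B_mul_right, Q_add] at h
  linear_combination h

lemma mul_mul_self (i : Fin 3) (a b : V) :
    S.m (i + 1) b (S.m i a b) = S.Q (i + 2) b • a := by
  refine S.ext_B (i + 1) fun c => ?_
  rw [B_cyclic', one_add_two, B_mul_right, map_smul, LinearMap.smul_apply, smul_eq_mul,
    S.B_comm _ c]
  ring

lemma self_mul_mul (i : Fin 3) (a b : V) :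
    S.m (i + 2) (S.m i a b) a = S.Q (i + 1) a • b := by
  refine S.ext_B (i + 2) fun c => ?_
  rw [B_cyclic, two_add_one, B_mul_left, map_smul, LinearMap.smul_apply, smul_eq_mul,
    S.B_comm _ c]

lemma mul_mul_polar (i : Fin 3) (a b c : V) :
    S.m (i + 1) b (S.m i a c) + S.m (i + 1) c (S.m i a b) = S.B (i + 2) b c • a := by
  have h := S.mul_mul_self i a (b + c)
  simp only [map_add, LinearMap.add_apply, mul_mul_self, Q_add, add_smul] at h
  rw [← sub_eq_zero] at h ⊢
  rw [← h]; abel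

lemma polar_mul_mul (i : Fin 3) (a b c : V) :
    S.m (i + 2) (S.m i a b) c + S.m (i + 2) (S.m i c b) a = S.B (i + 1) a c • b := by
  have h := S.self_mul_mul i (a + c) b
  simp only [map_add, LinearMap.add_apply, self_mul_mul, Q_add, add_smul] at h
  rw [← sub_eq_zero] at h ⊢
  rw [← h]; abel

/-- The middle Moufang identity. -/
lemma moufang (i : Fin 3) (a b c : V) :
    S.m i (S.m (i + 1) c a) (S.m (i + 2) a b)
      = S.B i a (S.m i b c) • a - S.Q i a • S.m i b c := by
  refine S.ext_B i fun w => ?_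
  have h := S.mul_mul_polar (i + 1) c w a
  simp only [one_add_one, one_add_two] at h
  have h1 := congrArg (fun t => S.B (i + 2) t (S.m (i + 2) a b)) h
  have h2 := S.B_mul_left (i + 2) a (S.m (i + 1) c w) b
  have h3 := S.B_cyclic i b c w
  have h4 := S.B_cyclic' i b c a
  simp only [two_add_one, two_add_two, map_add, LinearMap.add_apply, map_smul, map_sub,
    LinearMap.smul_apply, LinearMap.sub_apply, smul_eq_mul] at h1 h2 ⊢
  rw [B_cyclic', S.B_comm i a w, S.B_comm i a (S.m i b c), h4, h3, S.B_comm _ _ c]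
  linear_combination h1 - h2

lemma moufang_polar (i : Fin 3) (a a' b c : V) :
    S.m i (S.m (i + 1) c a) (S.m (i + 2) a' b) + S.m i (S.m (i + 1) c a') (S.m (i + 2) a b)
      = S.B i a (S.m i b c) • a' + S.B i a' (S.m i b c) • a - S.B i a a' • S.m i b c := by
  have h := S.moufang i (a + a') b c
  simp only [map_add, LinearMap.add_apply, moufang, Q_add] at h
  rw [← sub_eq_zero] at h ⊢
  rw [← h]; module

/-- The adjoint of the cubic norm structure on `F³ ⊕ V³` attached to a composition triple. -/
def sharp (x : (Fin 3 → F) × (Fin 3 → V)) : (Fin 3 → F) × (Fin 3 → V) :=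
  (fun i => x.1 (i + 1) * x.1 (i + 2) - S.Q i (x.2 i),
   fun i => S.m i (x.2 (i + 1)) (x.2 (i + 2)) - x.1 i • x.2 i)

/-- The polarisation of the adjoint. -/
def cross : ((Fin 3 → F) × (Fin 3 → V)) →ₗ[F] ((Fin 3 → F) × (Fin 3 → V)) →ₗ[F]
    ((Fin 3 → F) × (Fin 3 → V)) :=
  LinearMap.mk₂ F
    (fun x y =>
      (fun i => x.1 (i + 1) * y.1 (i + 2) + y.1 (i + 1) * x.1 (i + 2) - S.B i (x.2 i) (y.2 i),
       fun i => S.m i (x.2 (i + 1)) (y.2 (i + 2)) + S.m i (y.2 (i + 1)) (x.2 (i + 2))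
        - x.1 i • y.2 i - y.1 i • x.2 i))
    (fun x x' y => by
      ext i
      · simp; ring
      · simp; module)
    (fun c x y => by
      ext i
      · simp; ring
      · simp; module)
    (fun x y y' => by
      ext i
      · simp; ring
      · simp; module)
    (fun c x y => by
      ext i
      · simp; ring
      · simp; module)

lemma cross_fst (x y : (Fin 3 → F) × (Fin 3 → V)) (i : Fin 3) :
    (S.cross x y).1 i
      = x.1 (i + 1) * y.1 (i + 2) + y.1 (i + 1) * x.1 (i + 2) - S.B i (x.2 i) (y.2 i) := rfl

lemma cross_snd (x y : (Fin 3 → F) × (Fin 3 → V)) (i : Fin 3) :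
    (S.cross x y).2 i = S.m i (x.2 (i + 1)) (y.2 (i + 2)) + S.m i (y.2 (i + 1)) (x.2 (i + 2))
        - x.1 i • y.2 i - y.1 i • x.2 i := rfl

lemma sharp_add (x y : (Fin 3 → F) × (Fin 3 → V)) :
    S.sharp (x + y) = S.sharp x + S.sharp y + S.cross x y := by
  ext i
  · simp [sharp, cross_fst, Q_add]; ring
  · simp [sharp, cross_snd]; module

lemma cross_self (x : (Fin 3 → F) × (Fin 3 → V)) : S.cross x x = (2 : F) • S.sharp x := by
  ext i
  · simp [sharp, cross_fst, B_self]; ring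
  · simp [sharp, cross_snd]; module

lemma cross_comm (x y : (Fin 3 → F) × (Fin 3 → V)) : S.cross x y = S.cross y x := by
  ext i
  · simp only [cross_fst, S.B_comm i (x.2 i)]; ring
  · simp only [cross_snd]; module

/-- The trace bilinear form. -/
def form : ((Fin 3 → F) × (Fin 3 → V)) →ₗ[F] ((Fin 3 → F) × (Fin 3 → V)) →ₗ[F] F :=
  LinearMap.mk₂ F
    (fun x y => ∑ i, (x.1 i * y.1 i + S.B i (x.2 i) (y.2 i)))
    (fun x x' y => by
      simp only [← Finset.sum_add_distrib]
      refine Finset.sum_congr rfl fun i _ => ?_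
      simp; ring)
    (fun c x y => by
      simp only [Finset.smul_sum]
      refine Finset.sum_congr rfl fun i _ => ?_
      simp; ring)
    (fun x y y' => by
      simp only [← Finset.sum_add_distrib]
      refine Finset.sum_congr rfl fun i _ => ?_
      simp; ring)
    (fun c x y => by
      simp only [Finset.smul_sum]
      refine Finset.sum_congr rfl fun i _ => ?_
      simp; ring)

lemma form_apply (x y : (Fin 3 → F) × (Fin 3 → V)) :
    S.form x y = ∑ i, (x.1 i * y.1 i + S.B i (x.2 i) (y.2 i)) := rfl

lemma form_comm (x y : (Fin 3 → F) × (Fin 3 → V)) : S.form x y = S.form y x := by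
  simp only [form_apply]
  refine Finset.sum_congr rfl fun i _ => ?_
  rw [S.B_comm, mul_comm]

lemma form_single_fst (x : (Fin 3 → F) × (Fin 3 → V)) (i : Fin 3) (t : F) :
    S.form x (Pi.single i t, 0) = x.1 i * t := by
  rw [form_apply, sum_cyclic _ i]
  simp

lemma form_single_snd (x : (Fin 3 → F) × (Fin 3 → V)) (i : Fin 3) (a : V) :
    S.form x (0, Pi.single i a) = S.B i (x.2 i) a := by
  rw [form_apply, sum_cyclic _ i]
  simp

lemma ext_form {x y : (Fin 3 → F) × (Fin 3 → V)} (h : ∀ z, S.form x z = S.form y z) :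
    x = y := by
  ext i
  · simpa [form_single_fst] using h (Pi.single i 1, 0)
  · exact S.ext_B i fun a => by simpa [form_single_snd] using h (0, Pi.single i a)

lemma form_cross (x y z : (Fin 3 → F) × (Fin 3 → V)) :
    S.form (S.cross x y) z = S.form x (S.cross y z) := by
  have t1 (a b c : V) : S.B 1 (S.m 1 b c) a = S.B 0 (S.m 0 a b) c := (S.B_cyclic 0 a b c).symm
  have t2 (a b c : V) : S.B 2 (S.m 2 c a) b = S.B 0 (S.m 0 a b) c := S.B_cyclic 2 c a b
  simp only [form_apply, cross_fst, cross_snd, Fin.sum_univ_three, Fin.reduceAdd, zero_add,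
    map_add, map_sub, map_smul, LinearMap.add_apply, LinearMap.sub_apply,
    LinearMap.smul_apply, smul_eq_mul, S.B_comm _ (x.2 _) (S.m _ _ _), t1, t2]
  ring

/-- The adjoint of a cross product. -/
lemma sharp_cross (x y : (Fin 3 → F) × (Fin 3 → V)) :
    S.sharp (S.cross x y) + S.cross (S.sharp x) (S.sharp y)
      = S.form (S.sharp x) y • y + S.form x (S.sharp y) • x := by
  ext i
  · have t1 (a b c : V) : S.B (i + 1) (S.m (i + 1) b c) a = S.B i (S.m i a b) c :=
      (S.B_cyclic i a b c).symm
    have t2 (a b c : V) : S.B (i + 2) (S.m (i + 2) c a) b = S.B i (S.m i a b) c :=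
      (S.B_cyclic' i a b c).symm
    have h := S.B_mul_mul i (x.2 (i + 1)) (y.2 (i + 2)) (y.2 (i + 1)) (x.2 (i + 2))
    rw [form_comm _ x]
    simp only [sharp, form_apply, Prod.fst_add, Pi.add_apply, cross_fst, cross_snd, map_add,
      LinearMap.add_apply, map_smul, LinearMap.smul_apply, smul_eq_mul, Q_add, Q_neg, Q_smul,
      sub_eq_add_neg, one_add_one, one_add_two, two_add_one, two_add_two, comp, map_neg,
      LinearMap.neg_apply, sum_cyclic _ i, Prod.smul_fst, Pi.smul_apply, t1, t2,
      S.B_comm _ (y.2 _) (x.2 _), S.B_comm _ (x.2 _) (S.m _ _ _)]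
    rw [S.B_comm _ (y.2 _)] at h
    linear_combination -h
  · rw [form_comm _ x]
    have t1 (a b c : V) : S.B (i + 1) (S.m (i + 1) b c) a = S.B i (S.m i a b) c :=
      (S.B_cyclic i a b c).symm
    have t2 (a b c : V) : S.B (i + 2) (S.m (i + 2) c a) b = S.B i (S.m i a b) c :=
      (S.B_cyclic' i a b c).symm
    simp only [sharp, form_apply, Prod.snd_add, Pi.add_apply, cross_fst, cross_snd, map_add,
      LinearMap.add_apply, map_smul, LinearMap.smul_apply, smul_eq_mul, sub_eq_add_neg,
      one_add_one, one_add_two, two_add_one, two_add_two, map_neg, LinearMap.neg_apply,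
      sum_cyclic _ i, Prod.smul_snd, Pi.smul_apply, t1, t2, S.B_comm _ (y.2 _) (x.2 _)]
    generalize x.1 i = e0
    generalize x.1 (i + 1) = e1
    generalize x.1 (i + 2) = e2
    generalize y.1 i = f0
    generalize y.1 (i + 1) = f1
    generalize y.1 (i + 2) = f2
    generalize x.2 i = a0
    generalize x.2 (i + 1) = a1
    generalize x.2 (i + 2) = a2
    generalize y.2 i = b0
    generalize y.2 (i + 1) = b1
    generalize y.2 (i + 2) = b2
    have p (a b c : V) := S.polar_mul_mul (i + 1) a b c
    have q (a b c : V) := S.mul_mul_polar (i + 2) a b c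
    have p' (a b : V) := S.self_mul_mul (i + 1) a b
    have q' (a b : V) := S.mul_mul_self (i + 2) a b
    simp only [one_add_one, one_add_two, two_add_one, two_add_two] at p q p' q'
    have m1 := S.moufang i b0 a1 a2
    have m2 := S.moufang i a0 b1 b2
    have m3 := S.moufang_polar i b0 a0 b1 a2
    have m4 := S.moufang_polar i b0 a0 a1 b2
    simp only [p', q']
    simp only [S.B_comm i b0] at m1 m3 m4
    simp only [S.B_comm i a0 (S.m _ _ _)] at m2 m3 m4
    linear_combination (norm := module) m1 + m2 + m3 + m4 - e1 • q b0 a1 b1 - f1 • q a0 a1 b1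
      - e2 • p a2 b0 b2 - f2 • p a2 a0 b2

/-- For `d` of rank one, products of elements of `d × J` are multiples of `d`. -/
lemma cross_cross_cross {d : (Fin 3 → F) × (Fin 3 → V)} (hd : S.sharp d = 0)
    (y z : (Fin 3 → F) × (Fin 3 → V)) :
    S.cross (S.cross d y) (S.cross d z) = S.form (S.cross d y) z • d := by
  have h (y) : S.sharp (S.cross d y) = S.form d (S.sharp y) • d := by
    simpa [hd] using S.sharp_cross d y
  have h' := h (y + z)
  rw [map_add, sharp_add, sharp_add, h, h, map_add, map_add, add_smul, add_smul,
    add_right_inj] at h'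
  rw [h', form_cross]

lemma cross_cross_cross' {d : (Fin 3 → F) × (Fin 3 → V)} (hd : S.sharp d = 0)
    (y z : (Fin 3 → F) × (Fin 3 → V)) :
    S.cross d (S.cross y (S.cross d z)) = S.form d y • S.cross d z := by
  refine S.ext_form fun w => ?_
  rw [cross_comm, form_cross, form_cross, cross_cross_cross _ hd]
  simp [S.form_comm y d, mul_comm]

lemma form_cross_self {d : (Fin 3 → F) × (Fin 3 → V)} (hd : S.sharp d = 0)
    (y : (Fin 3 → F) × (Fin 3 → V)) : S.form d (S.cross d y) = 0 := by
  rw [← form_cross, cross_self, hd]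
  simp

lemma sharp_single_fst (i : Fin 3) : S.sharp (Pi.single i 1, 0) = 0 := by
  refine Prod.ext (funext_cyclic i ?_ ?_ ?_) (funext_cyclic i ?_ ?_ ?_) <;> simp [sharp]

section Finrank

variable [Module.Finite F V]

lemma finrank_range_cross_le {d f : (Fin 3 → F) × (Fin 3 → V)} (hd : S.sharp d = 0)
    (hdf : S.form d f ≠ 0) :
    Module.finrank F (LinearMap.range (S.cross d))
      ≤ Module.finrank F (LinearMap.range (S.cross f)) := by
  have h : LinearMap.range (S.cross d) ≤ (LinearMap.range (S.cross f)).map (S.cross d) := by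
    rintro _ ⟨z, rfl⟩
    refine ⟨_, ⟨(S.form d f)⁻¹ • S.cross d z, rfl⟩, ?_⟩
    rw [map_smul, map_smul, cross_cross_cross' _ hd, inv_smul_smul₀ hdf]
  exact (Submodule.finrank_mono h).trans (Submodule.finrank_map_le _ _)

lemma finrank_range_cross_eq {d f : (Fin 3 → F) × (Fin 3 → V)} (hd : S.sharp d = 0)
    (hf : S.sharp f = 0) (hdf : S.form d f ≠ 0) :
    Module.finrank F (LinearMap.range (S.cross d))
      = Module.finrank F (LinearMap.range (S.cross f)) :=
  (S.finrank_range_cross_le hd hdf).antisymm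
    (S.finrank_range_cross_le hf (by rwa [form_comm]))

lemma finrank_range_cross_single (i : Fin 3) :
    Module.finrank F (LinearMap.range (S.cross (Pi.single i 1, 0)))
      = 2 + Module.finrank F V := by
  let g : (F × F) × V →ₗ[F] (Fin 3 → F) × (Fin 3 → V) :=
    ((LinearMap.single F (fun _ => F) (i + 1)).coprod
      (LinearMap.single F (fun _ => F) (i + 2))).prodMap (LinearMap.single F (fun _ => V) i)
  have hg : Function.Injective g := by
    rw [injective_iff_map_eq_zero]
    rintro ⟨⟨s, t⟩, a⟩ h
    have h1 := congrFun (congrArg Prod.fst h) (i + 1)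
    have h2 := congrFun (congrArg Prod.fst h) (i + 2)
    have h3 := congrFun (congrArg Prod.snd h) i
    simp [g] at h1 h2 h3
    simp [h1, h2, h3]
  have h : LinearMap.range (S.cross (Pi.single i 1, 0)) = LinearMap.range g := by
    apply le_antisymm
    · rintro _ ⟨x, rfl⟩
      refine ⟨((x.1 (i + 2), x.1 (i + 1)), -x.2 i), ?_⟩
      refine Prod.ext (funext_cyclic i ?_ ?_ ?_) (funext_cyclic i ?_ ?_ ?_) <;>
        simp [cross_fst, cross_snd, g]
    · rintro _ ⟨⟨⟨s, t⟩, a⟩, rfl⟩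
      refine ⟨(Pi.single (i + 1) t + Pi.single (i + 2) s, Pi.single i (-a)), ?_⟩
      refine Prod.ext (funext_cyclic i ?_ ?_ ?_) (funext_cyclic i ?_ ?_ ?_) <;>
        simp [cross_fst, cross_snd, g]
  rw [h, LinearMap.finrank_range_of_inj hg]
  simp

/-- The image of `d × ·` has dimension `2 + dim V` for every rank one `d`. -/
theorem finrank_range_cross {d : (Fin 3 → F) × (Fin 3 → V)} (hd0 : d ≠ 0)
    (hd : S.sharp d = 0) :
    Module.finrank F (LinearMap.range (S.cross d)) = 2 + Module.finrank F V := by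
  have main {x : (Fin 3 → F) × (Fin 3 → V)} (hx : S.sharp x = 0) (i : Fin 3) (hi : x.1 i ≠ 0) :
      Module.finrank F (LinearMap.range (S.cross x)) = 2 + Module.finrank F V := by
    rw [S.finrank_range_cross_eq hx (S.sharp_single_fst i) (by simpa [form_single_fst]),
      finrank_range_cross_single]
  by_cases h : ∃ i, d.1 i ≠ 0
  · obtain ⟨i, hi⟩ := h
    exact main hd i hi
  push Not at h
  obtain ⟨i, hi⟩ : ∃ i, d.2 i ≠ 0 := by
    by_contra! h'
    exact hd0 (Prod.ext (funext h) (funext h'))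
  obtain ⟨u, hu⟩ : ∃ u, S.B i (d.2 i) u ≠ 0 := by
    by_contra! h'
    exact hi (S.nondeg i _ h')
  have hf : S.sharp (Pi.single (i + 1) 1 + Pi.single (i + 2) (S.Q i u), Pi.single i u) = 0 := by
    refine Prod.ext (funext_cyclic i ?_ ?_ ?_) (funext_cyclic i ?_ ?_ ?_) <;>
      simp [sharp]
  rw [S.finrank_range_cross_eq hd hf]
  · exact main hf (i + 1) (by simp)
  · rw [form_apply, sum_cyclic _ i]
    simpa [h] using hu

end Finrank

end CompositionTriple

namespace OctonionAlgebra

variable {F : Type u} [Field F] (O : OctonionAlgebra.{u, v} F)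

/-- The polar form of the norm. -/
def polarForm : O.C →ₗ[F] O.C →ₗ[F] F := O.n.polarBilin

lemma polarForm_apply (x y : O.C) : O.polarForm x y = O.n (x + y) - O.n x - O.n y := rfl

lemma polarForm_comm (x y : O.C) : O.polarForm x y = O.polarForm y x := by
  rw [polarForm_apply, polarForm_apply, add_comm x y]; ring

lemma n_add (x y : O.C) : O.n (x + y) = O.n x + O.n y + O.polarForm x y := by
  rw [polarForm_apply]; ring

lemma ext_polarForm {x y : O.C} (h : ∀ z, O.polarForm x z = O.polarForm y z) : x = y := by
  refine sub_eq_zero.1 (O.nondeg _ fun z => ?_)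
  have := h z
  rw [← sub_eq_zero, ← LinearMap.sub_apply, ← map_sub] at this
  exact this

lemma one_ne_zero : (1 : O.C) ≠ 0 := fun h => by
  simpa [h] using O.n_one

lemma polarForm_one_one : O.polarForm 1 1 = 2 := by
  have h : O.n ((2 : F) • (1 : O.C)) = 2 * 2 * O.n 1 := QuadraticMap.map_smul _ _ _
  rw [two_smul] at h
  rw [polarForm_apply, h, n_one]; ring

lemma conj_eq (x : O.C) : O.conj x = O.polarForm x 1 • (1 : O.C) - x := rfl

lemma polarForm_mul_right (x y z : O.C) :
    O.polarForm (x * z) (y * z) = O.polarForm x y * O.n z := by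
  rw [polarForm_apply, polarForm_apply, ← add_mul, n_mul, n_mul, n_mul]; ring

lemma polarForm_mul_mul (x y z w : O.C) :
    O.polarForm (x * y) (z * w) + O.polarForm (x * w) (z * y)
      = O.polarForm x z * O.polarForm y w := by
  have h := O.polarForm_mul_right x z (y + w)
  simp only [mul_add, map_add, LinearMap.add_apply, polarForm_mul_right, n_add] at h
  linear_combination h

lemma polarForm_mul_eq_right (x y z : O.C) :
    O.polarForm (x * y) z = O.polarForm y (O.conj x * z) := by
  have h := O.polarForm_mul_mul x y 1 z
  simp only [one_mul, O.polarForm_comm (x * z) y] at h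
  simp only [conj_eq, sub_mul, smul_mul_assoc, one_mul, map_sub, map_smul, smul_eq_mul]
  linear_combination h

lemma polarForm_mul_eq_left (x y z : O.C) :
    O.polarForm (x * y) z = O.polarForm x (z * O.conj y) := by
  have h := O.polarForm_mul_mul x y z 1
  simp only [mul_one] at h
  simp only [conj_eq, mul_sub, mul_smul_comm, mul_one, map_sub, map_smul, smul_eq_mul]
  linear_combination h

lemma conj_conj (x : O.C) : O.conj (O.conj x) = x := by
  have h : O.polarForm (O.conj x) 1 = O.polarForm x 1 := by
    simp only [conj_eq, map_sub, map_smul, LinearMap.sub_apply, LinearMap.smul_apply,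
      polarForm_one_one, smul_eq_mul]
    ring
  rw [conj_eq, h, conj_eq, sub_sub_cancel]

lemma polarForm_conj (x y : O.C) : O.polarForm (O.conj x) y = O.polarForm x (O.conj y) := by
  simp only [conj_eq, map_sub, map_smul, LinearMap.sub_apply, LinearMap.smul_apply, smul_eq_mul,
    O.polarForm_comm 1 y]
  ring

lemma n_conj (x : O.C) : O.n (O.conj x) = O.n x := by
  have h := O.n_add (O.conj x) x
  have h1 : O.conj x + x = O.polarForm x 1 • (1 : O.C) := by rw [conj_eq, sub_add_cancel]
  have h2 : O.polarForm x x = 2 * O.n x := by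
    have := O.polarForm_mul_right 1 1 x
    rwa [one_mul, polarForm_one_one] at this
  rw [h1, QuadraticMap.map_smul, n_one, conj_eq] at h
  simp only [map_sub, map_smul, LinearMap.sub_apply, LinearMap.smul_apply, smul_eq_mul,
    O.polarForm_comm 1 x, h2] at h
  rw [conj_eq]
  linear_combination -h

lemma conj_mul (x y : O.C) : O.conj (x * y) = O.conj y * O.conj x := by
  refine O.ext_polarForm fun z => ?_
  rw [polarForm_conj, polarForm_mul_eq_left, polarForm_comm, polarForm_mul_eq_right,
    polarForm_mul_eq_left, conj_conj, conj_conj]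

lemma mul_conj (x : O.C) : x * O.conj x = O.n x • (1 : O.C) := by
  refine O.ext_polarForm fun z => ?_
  have := O.polarForm_mul_right 1 z x
  rw [one_mul] at this
  rw [polarForm_mul_eq_left, conj_conj, this, map_smul, LinearMap.smul_apply, smul_eq_mul, mul_comm]

lemma conj_mul_self (x : O.C) : O.conj x * x = O.n x • (1 : O.C) := by
  simpa [conj_conj, n_conj] using O.mul_conj (O.conj x)

lemma conj_one : O.conj 1 = 1 := by
  rw [conj_eq, polarForm_one_one]; module

instance : Module.Finite F O.C :=
  Module.finite_of_finrank_pos (by rw [O.finrank_eq]; norm_num)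

end OctonionAlgebra

namespace ReducedAlbert

open CompositionTriple

variable {F : Type u} [Field F] (A : ReducedAlbert.{u, v} F)

/-- The ratio `γ_{i+2}⁻¹ γ_{i+1}`. -/
def ratio (i : Fin 3) : F := (A.γ (i + 2) : F)⁻¹ * (A.γ (i + 1) : F)

lemma ratio_ne_zero (i : Fin 3) : A.ratio i ≠ 0 := by simp [ratio]

lemma ratio_mul (i : Fin 3) : A.ratio (i + 1) * A.ratio (i + 2) = (A.ratio i)⁻¹ := by
  simp only [ratio, one_add_two, one_add_one, two_add_one, two_add_two]
  field_simp

/-- The composition triple given by the off-diagonal entries of a reduced Albert algebra. -/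
def triple : CompositionTriple F A.O.C where
  Q i := A.ratio i • A.O.n
  m i := (LinearMap.mul F A.O.C).compr₂ ((A.ratio i)⁻¹ • A.O.conj)
  comp i a b := by
    have := A.ratio_ne_zero i
    simp only [LinearMap.compr₂_apply, LinearMap.smul_apply, LinearMap.mul_apply',
      _root_.smul_apply, QuadraticMap.map_smul, OctonionAlgebra.n_conj,
      OctonionAlgebra.n_mul, smul_eq_mul]
    linear_combination (-(A.O.n a * A.O.n b)) * A.ratio_mul i
      + (A.O.n a * A.O.n b * (A.ratio i)⁻¹) * mul_inv_cancel₀ this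
  cyclic i a b c := by
    have h (j : Fin 3) (x y : A.O.C) :
        (A.ratio j • A.O.n).polarBilin ((A.ratio j)⁻¹ • x) y = A.O.polarForm x y := by
      rw [map_smul, LinearMap.smul_apply]
      change (A.ratio j)⁻¹ • QuadraticMap.polar (A.ratio j • ⇑A.O.n) x y = _
      rw [QuadraticMap.polar_smul, inv_smul_smul₀ (A.ratio_ne_zero j)]
      rfl
    simp only [LinearMap.compr₂_apply, LinearMap.smul_apply, LinearMap.mul_apply', h]
    rw [OctonionAlgebra.polarForm_conj, OctonionAlgebra.polarForm_conj,
      OctonionAlgebra.polarForm_mul_eq_right, OctonionAlgebra.polarForm_mul_eq_left]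
  nondeg i a h := by
    refine A.O.nondeg a fun b => ?_
    have := h b
    change QuadraticMap.polar (A.ratio i • ⇑A.O.n) a b = 0 at this
    rw [QuadraticMap.polar_smul] at this
    exact (smul_eq_zero.1 this).resolve_left (A.ratio_ne_zero i)

lemma triple_Q (i : Fin 3) (a : A.O.C) : A.triple.Q i a = A.ratio i * A.O.n a := rfl

lemma triple_m (i : Fin 3) (a b : A.O.C) :
    A.triple.m i a b = (A.ratio i)⁻¹ • A.O.conj (a * b) := rfl

lemma triple_B (i : Fin 3) (a b : A.O.C) : A.triple.B i a b = A.ratio i * A.O.polarForm a b := by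
  change QuadraticMap.polar (A.ratio i • ⇑A.O.n) a b = _
  rw [QuadraticMap.polar_smul]
  rfl

/-- The coordinates `elt` as a linear map. -/
def emb : ((Fin 3 → F) × (Fin 3 → A.O.C)) →ₗ[F] A.M where
  toFun x := A.elt x.1 (x.2 0) (x.2 1) (x.2 2)
  map_add' x y := by
    ext i j
    fin_cases i <;> fin_cases j <;> simp [elt, add_smul]
  map_smul' c x := by
    ext i j
    fin_cases i <;> fin_cases j <;> simp [elt, mul_smul, smul_comm c]

lemma emb_diag (x : (Fin 3 → F) × (Fin 3 → A.O.C)) (i : Fin 3) :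
    A.emb x i i = x.1 i • (1 : A.O.C) := by
  fin_cases i <;> rfl

lemma emb_upper (x : (Fin 3 → F) × (Fin 3 → A.O.C)) (i : Fin 3) :
    A.emb x (i + 1) (i + 2) = x.2 i := by
  fin_cases i <;> rfl

lemma emb_lower (x : (Fin 3 → F) × (Fin 3 → A.O.C)) (i : Fin 3) :
    A.emb x (i + 2) (i + 1) = A.ratio i • A.O.conj (x.2 i) := by
  fin_cases i <;> rfl

lemma ext_cyclic {x y : A.M} (h0 : ∀ i, x i i = y i i)
    (h1 : ∀ i, x (i + 1) (i + 2) = y (i + 1) (i + 2))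
    (h2 : ∀ i, x (i + 2) (i + 1) = y (i + 2) (i + 1)) : x = y := by
  ext r s
  have : s = r ∨ (∃ i, r = i + 1 ∧ s = i + 2) ∨ ∃ i, r = i + 2 ∧ s = i + 1 := by
    clear h0 h1 h2; decide +revert
  rcases this with rfl | ⟨i, rfl, rfl⟩ | ⟨i, rfl, rfl⟩
  exacts [h0 _, h1 _, h2 _]

lemma emb_injective : Function.Injective A.emb := by
  intro x y h
  refine Prod.ext (funext fun i => ?_) (funext fun i => ?_)
  · have := congrFun (congrFun h i) i
    rw [emb_diag, emb_diag] at this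
    exact smul_left_injective F A.O.one_ne_zero this
  · have := congrFun (congrFun h (i + 1)) (i + 2)
    rwa [emb_upper, emb_upper] at this

lemma emb_mem (x : (Fin 3 → F) × (Fin 3 → A.O.C)) : A.emb x ∈ A.J := by
  intro r s
  have : s = r ∨ (∃ i, r = i + 1 ∧ s = i + 2) ∨ ∃ i, r = i + 2 ∧ s = i + 1 := by
    decide +revert
  rcases this with rfl | ⟨i, rfl, rfl⟩ | ⟨i, rfl, rfl⟩
  · simp [emb_diag, OctonionAlgebra.conj_one]
  · rw [emb_upper, emb_lower, map_smul, OctonionAlgebra.conj_conj, smul_smul, ratio]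
    field_simp
    simp
  · rw [emb_upper, emb_lower, ratio]

lemma exists_emb_eq (h2 : (2 : F) ≠ 0) {x : A.M} (hx : x ∈ A.J) : ∃ y, A.emb y = x := by
  refine ⟨(fun i => 2⁻¹ * A.O.polarForm (x i i) 1, fun i => x (i + 1) (i + 2)),
    A.ext_cyclic (fun i => ?_) (fun i => ?_) (fun i => ?_)⟩
  · have h := hx i i
    simp only [ne_eq, Units.ne_zero, not_false_eq_true, inv_mul_cancel₀, one_smul,
      OctonionAlgebra.conj_eq] at h
    rw [eq_sub_iff_add_eq, ← two_smul F] at h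
    rw [emb_diag, mul_smul, ← h, inv_smul_smul₀ h2]
  · rw [emb_upper]
  · rw [emb_lower, hx]; rfl

lemma trace_emb (h2 : (2 : F) ≠ 0) (x : (Fin 3 → F) × (Fin 3 → A.O.C)) :
    A.trace (A.emb x) = ∑ i, x.1 i := by
  have h (i : Fin 3) : QuadraticMap.polar (⇑A.O.n) (A.emb x i i) 1 = 2 * x.1 i := by
    change A.O.polarForm _ _ = _
    rw [emb_diag, map_smul, LinearMap.smul_apply, OctonionAlgebra.polarForm_one_one, smul_eq_mul,
      mul_comm]
  simp only [trace, h, ← Finset.mul_sum]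
  rw [inv_mul_cancel_left₀ h2]

lemma emb_mul_emb_diag (x y : (Fin 3 → F) × (Fin 3 → A.O.C)) (i : Fin 3) :
    (A.emb x * A.emb y) i i = (x.1 i * y.1 i) • (1 : A.O.C)
      + A.ratio (i + 2) • (x.2 (i + 2) * A.O.conj (y.2 (i + 2)))
      + A.ratio (i + 1) • (A.O.conj (x.2 (i + 1)) * y.2 (i + 1)) := by
  have u1 (z) : A.emb z i (i + 1) = z.2 (i + 2) := by simpa using A.emb_upper z (i + 2)
  have u2 (z) : A.emb z (i + 2) i = z.2 (i + 1) := by simpa using A.emb_upper z (i + 1)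
  have l1 (z) := A.emb_lower z (i + 2)
  have l2 (z) := A.emb_lower z (i + 1)
  simp only [one_add_one, one_add_two, two_add_one, two_add_two] at l1 l2
  rw [Matrix.mul_apply, sum_cyclic _ i]
  simp only [u1, u2, l1, l2, emb_diag, smul_mul_assoc, mul_smul_comm, one_mul, smul_smul,
    mul_comm (y.1 i)]

lemma tb_emb (h2 : (2 : F) ≠ 0) (x y : (Fin 3 → F) × (Fin 3 → A.O.C)) :
    A.tb (A.emb x) (A.emb y) = A.triple.form x y := by
  have h (x y : (Fin 3 → F) × (Fin 3 → A.O.C)) (i : Fin 3) :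
      A.O.polarForm ((A.emb x * A.emb y) i i) 1 = 2 * (x.1 i * y.1 i)
        + A.triple.B (i + 2) (x.2 (i + 2)) (y.2 (i + 2))
        + A.triple.B (i + 1) (x.2 (i + 1)) (y.2 (i + 1)) := by
    rw [emb_mul_emb_diag]
    simp only [map_add, map_smul, LinearMap.add_apply, LinearMap.smul_apply, smul_eq_mul,
      OctonionAlgebra.polarForm_one_one, OctonionAlgebra.polarForm_mul_eq_left,
      OctonionAlgebra.polarForm_conj, OctonionAlgebra.conj_conj, one_mul, triple_B]
    ring
  have h' (i : Fin 3) : QuadraticMap.polar (⇑A.O.n) (A.jmul (A.emb x) (A.emb y) i i) 1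
      = 2⁻¹ * (A.O.polarForm ((A.emb x * A.emb y) i i) 1
        + A.O.polarForm ((A.emb y * A.emb x) i i) 1) := by
    rw [← LinearMap.add_apply, ← map_add, ← smul_eq_mul, ← LinearMap.smul_apply, ← map_smul]
    rfl
  simp only [tb, trace, h', h, form_apply, sum_cyclic _ (0 : Fin 3), A.triple.B_comm _ (y.2 _),
    one_add_one, one_add_two, two_add_one, two_add_two]
  field_simp
  ring

lemma sharp_emb (h2 : (2 : F) ≠ 0) (x : (Fin 3 → F) × (Fin 3 → A.O.C)) :
    A.sharp (A.emb x) = A.emb (A.triple.sharp x) := by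
  have hj : A.jmul (A.emb x) (A.emb x) = A.emb x * A.emb x := by
    rw [jmul, ← two_smul F, inv_smul_smul₀ h2]
  refine A.ext_cyclic (fun i => ?_) (fun i => ?_) (fun i => ?_)
  · simp only [sharp, hj, Matrix.add_apply, Matrix.sub_apply, Matrix.smul_apply, tb_emb A h2,
      trace_emb A h2, emb_mul_emb_diag, emb_diag, OctonionAlgebra.mul_conj,
      OctonionAlgebra.conj_mul_self, Matrix.one_apply_eq, CompositionTriple.sharp, form_apply,
      B_self, triple_Q, sum_cyclic _ i, smul_smul, ← add_smul, ← sub_smul]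
    congr 1
    field_simp
    ring
  · have l1 := A.emb_lower x (i + 2)
    have l2 := A.emb_lower x (i + 1)
    have hne : i + 1 ≠ i + 2 := (by decide : ∀ i : Fin 3, i + 1 ≠ i + 2) i
    simp only [one_add_one, one_add_two, two_add_one, two_add_two] at l1 l2
    simp only [sharp, hj, Matrix.add_apply, Matrix.sub_apply, Matrix.smul_apply,
      Matrix.one_apply_ne hne, trace_emb A h2, Matrix.mul_apply, sum_cyclic _ i, l1, l2,
      emb_diag, emb_upper, CompositionTriple.sharp, triple_m, OctonionAlgebra.conj_mul,
      smul_mul_assoc, mul_smul_comm, one_mul, mul_one, ← A.ratio_mul i]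
    module
  · have u1 := A.emb_upper x (i + 2)
    have u2 := A.emb_upper x (i + 1)
    have hne : i + 2 ≠ i + 1 := (by decide : ∀ i : Fin 3, i + 2 ≠ i + 1) i
    simp only [one_add_one, one_add_two, two_add_one, two_add_two] at u1 u2
    simp only [sharp, hj, Matrix.add_apply, Matrix.sub_apply, Matrix.smul_apply,
      Matrix.one_apply_ne hne, trace_emb A h2, Matrix.mul_apply, sum_cyclic _ i, u1, u2,
      emb_diag, emb_lower, CompositionTriple.sharp, triple_m, OctonionAlgebra.conj_conj,
      smul_mul_assoc, mul_smul_comm, one_mul, mul_one, map_sub, map_smul, smul_sub,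
      smul_inv_smul₀ (A.ratio_ne_zero i)]
    module

lemma cross_emb (h2 : (2 : F) ≠ 0) (x y : (Fin 3 → F) × (Fin 3 → A.O.C)) :
    A.cross (A.emb x) (A.emb y) = A.emb (A.triple.cross x y) := by
  rw [cross, ← map_add, sharp_emb A h2, sharp_emb A h2, sharp_emb A h2, ← map_sub, ← map_sub,
    sharp_add]
  congr 1
  abel

/-- The linear map whose range is the inner ideal attached to `d`. -/
def innerIdealMap (d : (Fin 3 → F) × (Fin 3 → A.O.C)) :
    (F × F) × LinearMap.range (A.triple.cross d) →ₗ[F] A.Bam where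
  toFun p := (p.1.1, p.1.2 • A.emb d, A.emb p.2, 0)
  map_add' p q := by simp [add_smul]
  map_smul' c p := by simp [mul_smul]

lemma innerIdealMap_injective {d : (Fin 3 → F) × (Fin 3 → A.O.C)} (hd : d ≠ 0) :
    Function.Injective (A.innerIdealMap d) := by
  rintro ⟨⟨a, b⟩, x, hx⟩ ⟨⟨a', b'⟩, y, hy⟩ h
  simp only [innerIdealMap, LinearMap.coe_mk, AddHom.coe_mk, Prod.mk.injEq, ← map_smul,
    A.emb_injective.eq_iff, and_true] at h
  obtain ⟨rfl, h1, rfl⟩ := h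
  rw [smul_left_injective F hd h1]

lemma finrank_range_innerIdealMap {d : (Fin 3 → F) × (Fin 3 → A.O.C)} (hd0 : d ≠ 0)
    (hd : A.triple.sharp d = 0) :
    Module.finrank F (LinearMap.range (A.innerIdealMap d)) = 12 := by
  rw [LinearMap.finrank_range_of_inj (A.innerIdealMap_injective hd0)]
  simp [finrank_range_cross A.triple hd0 hd, A.O.finrank_eq]

lemma mem_range_innerIdealMap {d : (Fin 3 → F) × (Fin 3 → A.O.C)} {p : A.Bam} :
    p ∈ LinearMap.range (A.innerIdealMap d) ↔
      ∃ α ξ : F, ∃ k, p = (α, ξ • A.emb d, A.emb (A.triple.cross d k), 0) := by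
  constructor
  · rintro ⟨⟨⟨α, ξ⟩, _, k, rfl⟩, rfl⟩
    exact ⟨α, ξ, k, rfl⟩
  · rintro ⟨α, ξ, k, rfl⟩
    exact ⟨((α, ξ), ⟨_, k, rfl⟩), rfl⟩

lemma bmul_emb (h2 : (2 : F) ≠ 0) (α α' β β' : F) (x x' y y') :
    A.bmul 1 (α, A.emb x, A.emb x', β) (α', A.emb y, A.emb y', β')
      = (α * α' + A.triple.form x y',
        A.emb (α • y + β' • x + A.triple.cross x' y'),
        A.emb (α' • x' + β • y' + A.triple.cross x y),
        β * β' + A.triple.form y x') := by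
  simp only [bmul, tb_emb A h2, cross_emb A h2, one_mul, one_smul, map_add, map_smul]

/-- `U_e(x)` for an element `e` of the inner ideal attached to a rank one `d`. -/
lemma brace_emb (h2 : (2 : F) ≠ 0) {d : (Fin 3 → F) × (Fin 3 → A.O.C)}
    (hd : A.triple.sharp d = 0) (α ξ μ ν : F) (k j j' : (Fin 3 → F) × (Fin 3 → A.O.C)) :
    ∃ a b : F, A.brace 1 (α, A.emb (ξ • d), A.emb (A.triple.cross d k), 0)
        (μ, A.emb j, A.emb j', ν) (α, A.emb (ξ • d), A.emb (A.triple.cross d k), 0)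
      = (a, b • A.emb d, A.emb (A.triple.cross d
          ((2 * (α * ν + A.triple.form j (A.triple.cross d k))) • k
            + (2 * ξ) • A.triple.cross (A.triple.cross d k) j'
            + (2 * α * ξ - A.triple.form (A.triple.cross d k) k) • j)), 0) := by
  set w := A.triple.cross d k with hw
  have hdd : A.triple.cross d d = 0 := by rw [CompositionTriple.cross_self, hd, smul_zero]
  have hdw : A.triple.form d w = 0 := A.triple.form_cross_self hd k
  have hdj : A.triple.form d (A.triple.cross d j) = 0 := A.triple.form_cross_self hd j
  have hww : A.triple.cross w w = A.triple.form w k • d := A.triple.cross_cross_cross hd k k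
  have hjw : A.triple.cross (A.triple.cross d j) w = A.triple.form (A.triple.cross d j) k • d :=
    A.triple.cross_cross_cross hd j k
  simp only [brace, binv, bmul_emb A h2]
  simp only [Prod.mk_add_mk, Prod.mk_sub_mk, Prod.mk.injEq, map_add, map_smul, map_zero,
    LinearMap.add_apply, LinearMap.smul_apply, hdd, hdw, hdj, hww, hjw, smul_zero, zero_smul,
    zero_mul, mul_zero, add_zero, zero_add, sub_self, LinearMap.zero_apply, smul_eq_mul,
    A.triple.cross_comm _ d, ← hw]
  refine ⟨_, 2 * ((α * ν + ξ * A.triple.form d j') * ξ + ν * A.triple.form w k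
    + ξ * A.triple.form (A.triple.cross d j) k) - ν * (2 * α * ξ + A.triple.form w k),
    rfl, ?_, ?_, ?_⟩
  · module
  · module
  · trivial

lemma range_innerIdealMap_isInnerIdeal (h2 : (2 : F) ≠ 0)
    {d : (Fin 3 → F) × (Fin 3 → A.O.C)} (hd : A.triple.sharp d = 0) :
    A.IsInnerIdeal 1 (LinearMap.range (A.innerIdealMap d)) := by
  constructor
  · rintro _ ⟨p, rfl⟩
    exact ⟨A.J.smul_mem _ (A.emb_mem d), A.emb_mem _⟩
  · rintro e he ⟨μ, x, x', ν⟩ ⟨hx, hx'⟩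
    obtain ⟨α, ξ, k, rfl⟩ := A.mem_range_innerIdealMap.1 he
    obtain ⟨j, rfl⟩ := A.exists_emb_eq h2 hx
    obtain ⟨j', rfl⟩ := A.exists_emb_eq h2 hx'
    obtain ⟨a, b, h⟩ := A.brace_emb h2 hd α ξ μ ν k j j'
    rw [map_smul] at h
    exact A.mem_range_innerIdealMap.2 ⟨a, b, _, h⟩

lemma not_isSingular_one_emb (h2 : (2 : F) ≠ 0) {d : (Fin 3 → F) × (Fin 3 → A.O.C)}
    (hd0 : d ≠ 0) (hd : A.triple.sharp d = 0) :
    ¬ A.IsSingular 1 ((1 : F), A.emb d, (0 : A.M), (0 : F)) := by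
  rintro ⟨-, h⟩
  have hcross (j : (Fin 3 → F) × (Fin 3 → A.O.C)) : A.triple.cross d j = 0 := by
    obtain ⟨c, hc⟩ := h (0, A.emb j, A.emb 0, 0) ⟨A.emb_mem j, A.emb_mem 0⟩
    obtain ⟨a, b, hb⟩ := A.brace_emb h2 hd 1 1 0 0 0 j 0
    rw [one_smul, map_zero, map_zero] at hb
    rw [map_zero, hb] at hc
    have h3 := congrArg (fun p : A.Bam => p.2.2.1) hc
    simpa [h2, A.emb_injective.eq_iff' (map_zero _)] using h3
  have h0 : A.triple.cross d = 0 := LinearMap.ext hcross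
  have := finrank_range_cross A.triple hd0 hd
  rw [h0, LinearMap.range_zero, finrank_bot] at this
  omega

end ReducedAlbert

/-- For `d ∈ J` of rank one, `I = {(α, ξd; d×k, 0) : α, ξ ∈ F, k ∈ J}` is a
12-dimensional inner ideal of `B(J,F×F)` which is not singular: `(1, d; 0, 0) ∈ I` is nonzero
and not singular. -/
theorem stmt11 {F : Type u} [Field F] (h2 : (2 : F) ≠ 0) (h3 : (3 : F) ≠ 0)
    (A : ReducedAlbert.{u, v} F) (d : A.M) (hd : d ∈ A.J) (hd0 : d ≠ 0)
    (hdsharp : A.sharp d = 0) :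
    ∃ I : Submodule F A.Bam,
      (I : Set A.Bam) = {p : A.Bam | ∃ α ξ : F, ∃ k ∈ A.J, p = (α, ξ • d, A.cross d k, 0)} ∧
      Module.finrank F I = 12 ∧
      A.IsInnerIdeal 1 I ∧
      (((1 : F), d, (0 : A.M), (0 : F)) ∈ I ∧
        (((1 : F), d, (0 : A.M), (0 : F)) : A.Bam) ≠ 0 ∧
        ¬ A.IsSingular 1 (((1 : F), d, (0 : A.M), (0 : F)) : A.Bam)) := by
  obtain ⟨δ, rfl⟩ := A.exists_emb_eq h2 hd
  have hδ0 : δ ≠ 0 := fun h => hd0 (by rw [h, map_zero])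
  have hδ : A.triple.sharp δ = 0 := by
    rwa [A.sharp_emb h2, A.emb_injective.eq_iff' (map_zero _)] at hdsharp
  refine ⟨LinearMap.range (A.innerIdealMap δ), ?_, A.finrank_range_innerIdealMap hδ0 hδ,
    A.range_innerIdealMap_isInnerIdeal h2 hδ, ?_, ?_, A.not_isSingular_one_emb h2 hδ0 hδ⟩
  · ext p
    rw [SetLike.mem_coe, A.mem_range_innerIdealMap]
    constructor
    · rintro ⟨α, ξ, k, rfl⟩
      exact ⟨α, ξ, A.emb k, A.emb_mem k, by rw [A.cross_emb h2]⟩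
    · rintro ⟨α, ξ, _, hk, rfl⟩
      obtain ⟨k, rfl⟩ := A.exists_emb_eq h2 hk
      exact ⟨α, ξ, k, by rw [A.cross_emb h2]⟩
  · exact A.mem_range_innerIdealMap.2 ⟨1, 1, 0, by simp⟩
  · exact fun h => one_ne_zero (congrArg Prod.fst h)
end
end
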